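/- arXiv:2201.05681 — 2 statements merged into one kernel-verified Lean document; each statement's English description precedes it below -/
import Mathlib

section
/- Let X be a complex Banach space and let f : ℝ → X be a bounded continuous function. For each z ∈ ℂ the Bochner integral G(z) = ∫_ℝ e^{−(t−z)²} • f(t) dt exists, the map z ↦ G(z) is entire (differentiable on all of ℂ), ‖G(z)‖ ≤ √π · e^{(Im z)²} · sup_{t∈ℝ} ‖f(t)‖ for every z ∈ ℂ, and for every real s one has G(s) = ∫_ℝ e^{−t²} • f(s + t) dt. -/
open MeasureTheory Real

/-- The modulus of the complex Gaussian kernel. -/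
lemma norm_cexp_neg_sub_sq (t : ℝ) (z : ℂ) :
    ‖Complex.exp (-((t : ℂ) - z) ^ 2)‖ = Real.exp (z.im ^ 2) * Real.exp (-1 * (t - z.re) ^ 2) := by
  rw [Complex.norm_exp, ← Real.exp_add]
  congr 1
  simp only [sq, Complex.neg_re, Complex.mul_re, Complex.sub_re, Complex.sub_im,
    Complex.ofReal_re, Complex.ofReal_im]
  ring

/-- A bound for the `z`-derivative of the Gaussian kernel, uniform for `z` in a unit ball. -/
lemma norm_cexp_neg_sub_sq_mul_le (t : ℝ) {z w : ℂ} (hz : ‖z - w‖ ≤ 1) :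
    ‖Complex.exp (-((t : ℂ) - z) ^ 2) * (2 * ((t : ℂ) - z))‖ ≤
      2 * Real.exp (3 / 2 * (|w.im| + 1) ^ 2 + 1 / 2) * Real.exp (-(1 / 4) * (t - w.re) ^ 2) := by
  have hre : |z.re - w.re| ≤ 1 := by simpa using (Complex.abs_re_le_norm (z - w)).trans hz
  have him : |z.im - w.im| ≤ 1 := by simpa using (Complex.abs_im_le_norm (z - w)).trans hz
  have hy : z.im ^ 2 ≤ (|w.im| + 1) ^ 2 := by
    rw [← sq_abs z.im]
    have : |z.im| ≤ |w.im| + 1 := by linarith [abs_sub_abs_le_abs_sub z.im w.im]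
    gcongr
  have hx : (t - w.re) ^ 2 / 2 - 1 ≤ (t - z.re) ^ 2 := by
    nlinarith [(sq_le_one_iff_abs_le_one _).2 hre, sq_nonneg ((t - z.re) - (z.re - w.re))]
  have hr : ‖(t : ℂ) - z‖ ≤ Real.exp (‖(t : ℂ) - z‖ ^ 2 / 2) := by
    nlinarith [Real.add_one_le_exp (‖(t : ℂ) - z‖ ^ 2 / 2), sq_nonneg (‖(t : ℂ) - z‖ - 1)]
  have hn : ‖(t : ℂ) - z‖ ^ 2 = (t - z.re) ^ 2 + z.im ^ 2 := by
    rw [Complex.sq_norm, Complex.normSq_apply]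
    simp only [Complex.sub_re, Complex.sub_im, Complex.ofReal_re, Complex.ofReal_im]
    ring
  rw [hn] at hr
  rw [norm_mul, norm_mul, norm_cexp_neg_sub_sq, Complex.norm_two]
  calc Real.exp (z.im ^ 2) * Real.exp (-1 * (t - z.re) ^ 2) * (2 * ‖(t : ℂ) - z‖)
      ≤ Real.exp (z.im ^ 2) * Real.exp (-1 * (t - z.re) ^ 2) *
          (2 * Real.exp (((t - z.re) ^ 2 + z.im ^ 2) / 2)) := by gcongr
    _ = 2 * Real.exp (3 / 2 * z.im ^ 2 - (t - z.re) ^ 2 / 2) := by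
      rw [mul_left_comm, ← Real.exp_add, ← Real.exp_add]
      ring_nf
    _ ≤ 2 * Real.exp (3 / 2 * (|w.im| + 1) ^ 2 + 1 / 2 + -(1 / 4) * (t - w.re) ^ 2) := by
      gcongr 2 * Real.exp ?_
      linarith
    _ = _ := by rw [Real.exp_add, mul_assoc]

/-- The Gaussian kernel is holomorphic in its centre. -/
lemma hasDerivAt_cexp_neg_sub_sq (t z : ℂ) :
    HasDerivAt (fun w : ℂ => Complex.exp (-(t - w) ^ 2))
      (Complex.exp (-(t - z) ^ 2) * (2 * (t - z))) z := by
  convert! (((hasDerivAt_id z).const_sub t).pow 2).neg.cexp using 1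
  simp

lemma continuous_cexp_neg_sub_sq (z : ℂ) :
    Continuous fun t : ℝ => Complex.exp (-((t : ℂ) - z) ^ 2) := by
  fun_prop

lemma integrable_exp_neg_mul_sub_sq {b : ℝ} (hb : 0 < b) (a : ℝ) :
    Integrable fun t : ℝ => Real.exp (-b * (t - a) ^ 2) :=
  (integrable_exp_neg_mul_sq hb).comp_sub_right a

/-- For a bounded continuous function `f : ℝ → X` into a complex Banach space, the
Gaussian regularization `G z = ∫ ℝ e^{-(t-z)²} • f t dt` exists for every `z ∈ ℂ`,
is entire in `z`, satisfies `‖G z‖ ≤ √π e^{(Im z)²} sup_t ‖f t‖`, and for real `s`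
one has `G s = ∫ ℝ e^{-t²} • f (s + t) dt`. -/
theorem gaussian_regularization_entire
    {X : Type*} [NormedAddCommGroup X] [NormedSpace ℂ X] [CompleteSpace X]
    (f : ℝ → X) (hf_cont : Continuous f) (hf_bdd : ∃ C : ℝ, ∀ t : ℝ, ‖f t‖ ≤ C)
    (G : ℂ → X)
    (hG : ∀ z : ℂ, G z = ∫ t : ℝ, Complex.exp (-((t : ℂ) - z) ^ 2) • f t) :
    (∀ z : ℂ, Integrable (fun t : ℝ => Complex.exp (-((t : ℂ) - z) ^ 2) • f t)) ∧
    Differentiable ℂ G ∧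
    (∀ z : ℂ, ‖G z‖ ≤ Real.sqrt π * Real.exp (z.im ^ 2) * ⨆ t : ℝ, ‖f t‖) ∧
    (∀ s : ℝ, G (s : ℂ) = ∫ t : ℝ, Real.exp (-t ^ 2) • f (s + t)) := by
  obtain ⟨C, hC⟩ := hf_bdd
  have hf_int : ∀ z : ℂ, Integrable (fun t : ℝ => Complex.exp (-((t : ℂ) - z) ^ 2) • f t) := by
    intro z
    refine Integrable.mono'
      (((integrable_exp_neg_mul_sub_sq one_pos z.re).const_mul (Real.exp (z.im ^ 2))).mul_const C)
      ((continuous_cexp_neg_sub_sq z).smul hf_cont).aestronglyMeasurable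
      (ae_of_all _ fun t => ?_)
    rw [norm_smul, norm_cexp_neg_sub_sq]
    gcongr
    exact hC t
  refine ⟨hf_int, fun z => ?_, fun z => ?_, fun s => ?_⟩
  · rw [funext hG]
    refine (hasDerivAt_integral_of_dominated_loc_of_deriv_le
      (F' := fun w t => (Complex.exp (-((t : ℂ) - w) ^ 2) * (2 * ((t : ℂ) - w))) • f t)
      (Metric.ball_mem_nhds z one_pos)
      (Filter.Eventually.of_forall fun w => (hf_int w).aestronglyMeasurable) (hf_int z) ?_
      (ae_of_all _ fun t w hw => ?_)
      (((integrable_exp_neg_mul_sub_sq (b := 1 / 4) (by norm_num) z.re).const_mul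
        (2 * Real.exp (3 / 2 * (|z.im| + 1) ^ 2 + 1 / 2))).mul_const C)
      (ae_of_all _ fun t w _ => (hasDerivAt_cexp_neg_sub_sq t w).smul_const (f t))).2.differentiableAt
    · exact Continuous.aestronglyMeasurable (by fun_prop)
    · rw [norm_smul]
      gcongr
      · exact norm_cexp_neg_sub_sq_mul_le t (mem_ball_iff_norm.1 hw).le
      · exact hC t
  · have hsup : ∀ t, ‖f t‖ ≤ ⨆ t : ℝ, ‖f t‖ := le_ciSup ⟨C, Set.forall_mem_range.2 hC⟩
    have hgauss : ∫ t : ℝ, Real.exp (-1 * (t - z.re) ^ 2) = Real.sqrt π := by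
      rw [integral_sub_right_eq_self (fun t : ℝ => Real.exp (-1 * t ^ 2)) z.re,
        integral_gaussian, div_one]
    calc ‖G z‖ ≤ ∫ t : ℝ, Real.exp (z.im ^ 2) * Real.exp (-1 * (t - z.re) ^ 2) *
          ⨆ t : ℝ, ‖f t‖ := by
          rw [hG]
          refine norm_integral_le_of_norm_le
            (((integrable_exp_neg_mul_sub_sq one_pos z.re).const_mul _).mul_const _)
            (ae_of_all _ fun t => ?_)
          rw [norm_smul, norm_cexp_neg_sub_sq]
          gcongr
          exact hsup t
      _ = _ := by
          rw [integral_mul_const, integral_const_mul, hgauss, mul_comm (Real.exp _)]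
  · rw [hG, ← integral_add_left_eq_self _ s]
    congr 1 with t
    rw [← Complex.coe_smul (Real.exp _)]
    push_cast
    ring_nf
end

section
/- Let X be a complex Banach space and let (α_t)_{t∈ℝ} be a one-parameter group of surjective linear isometries of X, i.e., α_0 = id, α_{s+t} = α_s ∘ α_t for all s, t ∈ ℝ, each α_t is a linear isometry of X onto X, and t ↦ α_t(x) is continuous for every x ∈ X. Fix x ∈ X and define, for z ∈ ℂ, G(z) = π^{−1/2} ∫_ℝ e^{−(t−z)²} • α_t(x) dt (a Bochner integral, which exists). Then: (i) G is entire; (ii) G(s) = α_s(G(0)) for every real s, and more generally α_s(G(z)) = G(z + s) for all s ∈ ℝ and z ∈ ℂ; (iii) ‖G(z)‖ ≤ e^{(Im z)²} · ‖x‖ for every z ∈ ℂ. -/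
open MeasureTheory Real

theorem norm_cexp_neg_ofReal_sub_sq (t : ℝ) (z : ℂ) :
    ‖Complex.exp (-((t : ℂ) - z) ^ 2)‖ = rexp (z.im ^ 2) * rexp (-(t - z.re) ^ 2) := by
  rw [Complex.norm_exp, ← Real.exp_add]
  congr 1
  simp [sq]
  ring

theorem integrable_exp_neg_sub_sq (a : ℝ) : Integrable fun t : ℝ => rexp (-(t - a) ^ 2) := by
  simpa using (integrable_exp_neg_mul_sq one_pos).comp_sub_right a

theorem integral_exp_neg_sub_sq (a : ℝ) : ∫ t : ℝ, rexp (-(t - a) ^ 2) = √π := by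
  rw [integral_sub_right_eq_self (fun t : ℝ => rexp (-t ^ 2)) a]
  simpa using integral_gaussian 1

section GaussianTransform

variable {X : Type*} [NormedAddCommGroup X] [NormedSpace ℂ X] {f : ℝ → X} {C : ℝ}

theorem norm_cexp_neg_sub_sq_smul_le (hC : ∀ t, ‖f t‖ ≤ C) (z : ℂ) (t : ℝ) :
    ‖Complex.exp (-((t : ℂ) - z) ^ 2) • f t‖ ≤
      rexp (z.im ^ 2) * rexp (-(t - z.re) ^ 2) * C := by
  rw [norm_smul, norm_cexp_neg_ofReal_sub_sq]
  exact mul_le_mul_of_nonneg_left (hC t) (by positivity)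

theorem integrable_cexp_neg_sub_sq_smul (hf : Continuous f) (hC : ∀ t, ‖f t‖ ≤ C) (z : ℂ) :
    Integrable fun t : ℝ => Complex.exp (-((t : ℂ) - z) ^ 2) • f t :=
  (((integrable_exp_neg_sub_sq z.re).const_mul _).mul_const C).mono'
    (by fun_prop) (.of_forall (norm_cexp_neg_sub_sq_smul_le hC z))

theorem norm_integral_cexp_neg_sub_sq_smul_le (hC : ∀ t, ‖f t‖ ≤ C) (z : ℂ) :
    ‖∫ t : ℝ, Complex.exp (-((t : ℂ) - z) ^ 2) • f t‖ ≤ rexp (z.im ^ 2) * √π * C := by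
  refine (norm_integral_le_of_norm_le
    (((integrable_exp_neg_sub_sq z.re).const_mul _).mul_const C)
    (.of_forall (norm_cexp_neg_sub_sq_smul_le hC z))).trans_eq ?_
  rw [integral_mul_const, integral_const_mul, integral_exp_neg_sub_sq]

/-- A bound for the `z`-derivative of the complex Gaussian, locally uniform in `z`. -/
theorem norm_deriv_cexp_neg_sub_sq_le {z w : ℂ} (hw : w ∈ Metric.ball z 1) (t : ℝ) :
    ‖Complex.exp (-((t : ℂ) - w) ^ 2) * (2 * ((t : ℂ) - w))‖ ≤
      2 * rexp ((|z.im| + 1) ^ 2 + 1) *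
        (‖(t - z.re) * rexp (-(1 / 2) * (t - z.re) ^ 2)‖ +
          (|z.im| + 1) * rexp (-(1 / 2) * (t - z.re) ^ 2)) := by
  have hd : ‖w - z‖ < 1 := by simpa [dist_eq_norm] using hw
  have hre : |w.re - z.re| ≤ 1 := by
    simpa using (Complex.abs_re_le_norm (w - z)).trans hd.le
  have him : |w.im| ≤ |z.im| + 1 := by
    have h : |w.im - z.im| ≤ 1 := by
      simpa using (Complex.abs_im_le_norm (w - z)).trans hd.le
    linarith [abs_sub_abs_le_abs_sub w.im z.im]
  have hlin : ‖(t : ℂ) - w‖ ≤ |t - z.re| + (|z.im| + 1) := by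
    have h₁ : ‖(t : ℂ) - z‖ ≤ |t - z.re| + |z.im| := by
      simpa using Complex.norm_le_abs_re_add_abs_im ((t : ℂ) - z)
    have h₂ := norm_sub_le_norm_sub_add_norm_sub (t : ℂ) z w
    rw [norm_sub_rev z w] at h₂
    linarith
  have hexp : ‖Complex.exp (-((t : ℂ) - w) ^ 2)‖ ≤
      rexp ((|z.im| + 1) ^ 2 + 1) * rexp (-(1 / 2) * (t - z.re) ^ 2) := by
    rw [norm_cexp_neg_ofReal_sub_sq, ← Real.exp_add, ← Real.exp_add, Real.exp_le_exp]
    have h₁ : w.im ^ 2 ≤ (|z.im| + 1) ^ 2 := sq_le_sq.2 (him.trans (le_abs_self _))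
    have h₂ : (w.re - z.re) ^ 2 ≤ 1 := by
      simpa using sq_le_sq.2 (hre.trans_eq abs_one.symm)
    nlinarith [sq_nonneg ((t - w.re) - (w.re - z.re))]
  calc
    _ = ‖Complex.exp (-((t : ℂ) - w) ^ 2)‖ * (2 * ‖(t : ℂ) - w‖) := by simp
    _ ≤ rexp ((|z.im| + 1) ^ 2 + 1) * rexp (-(1 / 2) * (t - z.re) ^ 2) *
        (2 * (|t - z.re| + (|z.im| + 1))) := by gcongr
    _ = _ := by
      rw [norm_mul, Real.norm_eq_abs, Real.norm_of_nonneg (Real.exp_pos _).le]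
      ring

theorem differentiable_integral_cexp_neg_sub_sq_smul (hf : Continuous f)
    (hC : ∀ t, ‖f t‖ ≤ C) :
    Differentiable ℂ fun z : ℂ => ∫ t : ℝ, Complex.exp (-((t : ℂ) - z) ^ 2) • f t := by
  intro z
  have hhalf : (0 : ℝ) < 1 / 2 := by norm_num
  refine (hasDerivAt_integral_of_dominated_loc_of_deriv_le
    (F := fun (w : ℂ) (t : ℝ) => Complex.exp (-((t : ℂ) - w) ^ 2) • f t)
    (F' := fun (w : ℂ) (t : ℝ) =>
      (Complex.exp (-((t : ℂ) - w) ^ 2) * (2 * ((t : ℂ) - w))) • f t)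
    (bound := fun t : ℝ => 2 * rexp ((|z.im| + 1) ^ 2 + 1) *
        (‖(t - z.re) * rexp (-(1 / 2) * (t - z.re) ^ 2)‖ +
          (|z.im| + 1) * rexp (-(1 / 2) * (t - z.re) ^ 2)) * C)
    (Metric.ball_mem_nhds z one_pos) (.of_forall fun w => ?_)
    (integrable_cexp_neg_sub_sq_smul hf hC z) ?_ (.of_forall fun t w hw => ?_) ?_
    (.of_forall fun t w _ => ?_)).2.differentiableAt
  · fun_prop
  · fun_prop
  · rw [norm_smul]
    exact mul_le_mul (norm_deriv_cexp_neg_sub_sq_le hw t) (hC t) (norm_nonneg _) (by positivity)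
  · exact ((((integrable_mul_exp_neg_mul_sq hhalf).comp_sub_right z.re).norm.add
      (((integrable_exp_neg_mul_sq hhalf).comp_sub_right z.re).const_mul _)).const_mul
        _).mul_const C
  · have h : HasDerivAt (fun w : ℂ => -((t : ℂ) - w) ^ 2) (2 * ((t : ℂ) - w)) w :=
      (((hasDerivAt_id w).const_sub (t : ℂ)).pow 2).neg.congr_deriv (by simp)
    exact h.cexp.smul_const (f t)

end GaussianTransform

/-- For a strongly continuous one-parameter group `(α_t)` of surjective linear isometries
of a complex Banach space `X` and `x ∈ X`, the Gaussian regularization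
`G z = π^{-1/2} ∫ ℝ e^{-(t-z)²} • α_t x dt` exists, is entire, commutes with the group in
the sense `α_s (G z) = G (z + s)` (in particular `G s = α_s (G 0)` for real `s`), and
satisfies `‖G z‖ ≤ e^{(Im z)²} ‖x‖`. -/
theorem gaussian_regularization_of_isometry_group
    {X : Type*} [NormedAddCommGroup X] [NormedSpace ℂ X] [CompleteSpace X]
    (α : ℝ → X ≃ₗᵢ[ℂ] X)
    (h0 : α 0 = LinearIsometryEquiv.refl ℂ X)
    (hgroup : ∀ s t : ℝ, ∀ x : X, α (s + t) x = α s (α t x))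
    (hcont : ∀ x : X, Continuous fun t : ℝ => α t x)
    (x : X) (G : ℂ → X)
    (hG : ∀ z : ℂ,
      G z = (Real.sqrt π : ℂ)⁻¹ • ∫ t : ℝ, Complex.exp (-((t : ℂ) - z) ^ 2) • α t x) :
    (∀ z : ℂ, Integrable (fun t : ℝ => Complex.exp (-((t : ℂ) - z) ^ 2) • α t x)) ∧
    Differentiable ℂ G ∧
    (∀ s : ℝ, G (s : ℂ) = α s (G 0)) ∧
    (∀ (s : ℝ) (z : ℂ), α s (G z) = G (z + (s : ℂ))) ∧
    (∀ z : ℂ, ‖G z‖ ≤ Real.exp (z.im ^ 2) * ‖x‖) := by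
  have hC : ∀ t, ‖α t x‖ ≤ ‖x‖ := fun t => ((α t).norm_map x).le
  have hshift (s : ℝ) (z : ℂ) : α s (G z) = G (z + (s : ℂ)) := by
    rw [hG, hG, map_smul, ← integral_add_left_eq_self
      (fun t : ℝ => Complex.exp (-((t : ℂ) - (z + (s : ℂ))) ^ 2) • α t x) s]
    congr 1
    refine ((α s).toContinuousLinearEquiv.integral_comp_comm _).symm.trans ?_
    refine integral_congr_ae (.of_forall fun t => ?_)
    simp [hgroup, add_comm z]
  refine ⟨integrable_cexp_neg_sub_sq_smul (hcont x) hC, ?_, fun s => ?_, hshift, fun z => ?_⟩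
  · rw [funext hG]
    exact (differentiable_integral_cexp_neg_sub_sq_smul (hcont x) hC).const_smul _
  · rw [hshift, zero_add]
  · have hπ : 0 < √π := Real.sqrt_pos.2 pi_pos
    rw [hG, norm_smul, norm_inv, Complex.norm_of_nonneg hπ.le, inv_mul_le_iff₀ hπ]
    exact (norm_integral_cexp_neg_sub_sq_smul_le hC z).trans_eq (by ring)
end
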